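/- Let the problem (P) be weakly Levitin-Polyak well-posed in the extended sense. Then the penalty function F_c is globally exact if and only if the following three conditions hold: (1) F_c has the zero duality gap property; (2) F_c is non-degenerate in the extended sense; (3) F_c is uniformly locally exact at globally optimal solutions of (P). -/

import Mathlib

open Metric Filter Topology Set ENNReal Bornology

noncomputable section

/-- The set of globally optimal solutions of problem (P):
minimize `f x` subject to `x ∈ M` and `x ∈ Q`, where `fstar` is the optimal value. -/
def argminP {X : Type*} (M Q : Set X) (f : X → EReal) (fstar : ℝ) : Set X :=
  {x | x ∈ M ∩ Q ∧ f x = (fstar : EReal)}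

/-- `phi` is a penalty term (infeasibility measure) for the constraint `x ∈ M` on `Q`. -/
def IsPenaltyTerm {X : Type*} (M Q : Set X) (phi : X → ℝ≥0∞) : Prop :=
  ∀ x ∈ Q, (phi x = 0 ↔ x ∈ M)

/-- The penalty function `F_c x = f x + c * phi x`. -/
def Pen {X : Type*} (f : X → EReal) (phi : X → ℝ≥0∞) (c : ℝ) (x : X) : EReal :=
  f x + (c : EReal) * (phi x : EReal)

/-- Some subsequence of `x` converges to a point of `S`. -/
def HasSubseqConvTo {X : Type*} [MetricSpace X] (x : ℕ → X) (S : Set X) : Prop :=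
  ∃ (σ : ℕ → ℕ) (p : X), StrictMono σ ∧ p ∈ S ∧ Tendsto (fun k => x (σ k)) atTop (𝓝 p)

/-- Problem (P) is Tykhonov well-posed in the extended sense. -/
def TykhonovWPExt {X : Type*} [MetricSpace X] (M Q : Set X) (f : X → EReal) (fstar : ℝ) :
    Prop :=
  (argminP M Q f fstar).Nonempty ∧
    ∀ x : ℕ → X, (∀ n, x n ∈ M ∩ Q) →
      Tendsto (fun n => f (x n)) atTop (𝓝 (fstar : EReal)) →
      HasSubseqConvTo x (argminP M Q f fstar)

/-- Problem (P) is weakly Tykhonov well-posed in the extended sense. -/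
def WeakTykhonovWPExt {X : Type*} [MetricSpace X] (M Q : Set X) (f : X → EReal) (fstar : ℝ) :
    Prop :=
  (argminP M Q f fstar).Nonempty ∧
    ∀ x : ℕ → X, (∀ n, x n ∈ M ∩ Q) →
      Tendsto (fun n => f (x n)) atTop (𝓝 (fstar : EReal)) →
      Tendsto (fun n => infDist (x n) (argminP M Q f fstar)) atTop (𝓝 0)

/-- Problem (P) is Levitin-Polyak well-posed in the extended sense. -/
def LevitinPolyakWPExt {X : Type*} [MetricSpace X] (M Q : Set X) (f : X → EReal) (fstar : ℝ) :
    Prop :=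
  (argminP M Q f fstar).Nonempty ∧
    ∀ x : ℕ → X,
      Tendsto (fun n => f (x n)) atTop (𝓝 (fstar : EReal)) →
      Tendsto (fun n => infDist (x n) (M ∩ Q)) atTop (𝓝 0) →
      HasSubseqConvTo x (argminP M Q f fstar)

/-- Problem (P) is weakly Levitin-Polyak well-posed in the extended sense. -/
def WeakLevitinPolyakWPExt {X : Type*} [MetricSpace X] (M Q : Set X) (f : X → EReal)
    (fstar : ℝ) : Prop :=
  (argminP M Q f fstar).Nonempty ∧
    ∀ x : ℕ → X,
      Tendsto (fun n => f (x n)) atTop (𝓝 (fstar : EReal)) →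
      Tendsto (fun n => infDist (x n) (M ∩ Q)) atTop (𝓝 0) →
      Tendsto (fun n => infDist (x n) (argminP M Q f fstar)) atTop (𝓝 0)

/-- Problem (P) is Levitin-Polyak well-posed with respect to the infeasibility measure `phi`. -/
def LevitinPolyakWPwrt {X : Type*} [MetricSpace X] (M Q : Set X) (f : X → EReal)
    (phi : X → ℝ≥0∞) (fstar : ℝ) : Prop :=
  (argminP M Q f fstar).Nonempty ∧
    ∀ x : ℕ → X,
      Tendsto (fun n => f (x n)) atTop (𝓝 (fstar : EReal)) →
      Tendsto (fun n => phi (x n)) atTop (𝓝 (0 : ℝ≥0∞)) →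
      HasSubseqConvTo x (argminP M Q f fstar)

/-- Problem (P) is weakly Levitin-Polyak well-posed with respect to the infeasibility
measure `phi`. -/
def WeakLevitinPolyakWPwrt {X : Type*} [MetricSpace X] (M Q : Set X) (f : X → EReal)
    (phi : X → ℝ≥0∞) (fstar : ℝ) : Prop :=
  (argminP M Q f fstar).Nonempty ∧
    ∀ x : ℕ → X,
      Tendsto (fun n => f (x n)) atTop (𝓝 (fstar : EReal)) →
      Tendsto (fun n => phi (x n)) atTop (𝓝 (0 : ℝ≥0∞)) →
      Tendsto (fun n => infDist (x n) (argminP M Q f fstar)) atTop (𝓝 0)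

/-- `F` attains a global minimum on `Q`. -/
def AttainsGlobMin {X : Type*} (F : X → EReal) (Q : Set X) : Prop :=
  ∃ x ∈ Q, ∀ y ∈ Q, F x ≤ F y

/-- The penalty function `F_c` is globally exact: for all sufficiently large `c ≥ 0`
the set of global minimizers of `F_c` on `Q` coincides with `argminP`. -/
def GloballyExactPen {X : Type*} (M Q : Set X) (f : X → EReal) (phi : X → ℝ≥0∞)
    (fstar : ℝ) : Prop :=
  ∃ cs : ℝ, 0 ≤ cs ∧ ∀ c ≥ cs,
    {x | x ∈ Q ∧ ∀ y ∈ Q, Pen f phi c x ≤ Pen f phi c y} = argminP M Q f fstar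

/-- The zero duality gap property: `sup_{c ≥ 0} inf_{x ∈ Q} F_c x = fstar`. -/
def ZeroDualityGap {X : Type*} (Q : Set X) (f : X → EReal) (phi : X → ℝ≥0∞) (fstar : ℝ) :
    Prop :=
  (⨆ c : ℝ, ⨆ _ : (0 : ℝ) ≤ c, ⨅ x ∈ Q, Pen f phi c x) = (fstar : EReal)

/-- `x₀` is a local minimizer of `F` on `Q`. -/
def IsLocalMinOnSet {X : Type*} [MetricSpace X] (F : X → EReal) (Q : Set X) (x₀ : X) : Prop :=
  ∃ r > (0 : ℝ), ∀ x ∈ Q, dist x x₀ ≤ r → F x₀ ≤ F x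

/-- The penalty function `F_c` is locally exact at `x₀`. -/
def LocallyExactAt {X : Type*} [MetricSpace X] (f : X → EReal) (phi : X → ℝ≥0∞)
    (Q : Set X) (x₀ : X) : Prop :=
  ∃ cs : ℝ, 0 ≤ cs ∧ ∀ c ≥ cs, IsLocalMinOnSet (Pen f phi c) Q x₀

/-- The least exact penalty parameter `c_*(x₀)` at `x₀`. -/
def penCStarAt {X : Type*} [MetricSpace X] (f : X → EReal) (phi : X → ℝ≥0∞)
    (Q : Set X) (x₀ : X) : ℝ :=
  sInf {cs : ℝ | 0 ≤ cs ∧ ∀ c ≥ cs, IsLocalMinOnSet (Pen f phi c) Q x₀}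

/-- The radius of local exactness `r_*(x₀, cs)`: the supremum of all `r > 0` such that
`F_c x ≥ F_c x₀` for every `x ∈ B(x₀, r) ∩ Q` and every `c ≥ cs` (as an extended real). -/
def penRadiusAt {X : Type*} [MetricSpace X] (f : X → EReal) (phi : X → ℝ≥0∞)
    (Q : Set X) (x₀ : X) (cs : ℝ) : EReal :=
  sSup (Real.toEReal ''
    {r : ℝ | 0 < r ∧ ∀ c ≥ cs, ∀ x ∈ Q, dist x x₀ ≤ r → Pen f phi c x₀ ≤ Pen f phi c x})

/-- `F_c` is uniformly locally exact at globally optimal solutions of (P). -/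
def UniformlyLocallyExact {X : Type*} [MetricSpace X] (M Q : Set X) (f : X → EReal)
    (phi : X → ℝ≥0∞) (fstar : ℝ) : Prop :=
  (∀ x₀ ∈ argminP M Q f fstar, LocallyExactAt f phi Q x₀) ∧
    ∃ cs rs : ℝ, 0 < cs ∧ 0 < rs ∧
      ∀ x₀ ∈ argminP M Q f fstar,
        penCStarAt f phi Q x₀ < cs ∧ (rs : EReal) ≤ penRadiusAt f phi Q x₀ cs

/-- `F_c` is non-degenerate in the extended sense. -/
def NondegenerateExt {X : Type*} [MetricSpace X] (M Q : Set X) (f : X → EReal)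
    (phi : X → ℝ≥0∞) : Prop :=
  ∃ cs : ℝ, 0 ≤ cs ∧ ∃ xc : ℝ → X,
    (∀ c ≥ cs, xc c ∈ Q ∧ ∀ y ∈ Q, Pen f phi c (xc c) ≤ Pen f phi c y) ∧
    Tendsto (fun c => infDist (xc c) (M ∩ Q)) atTop (𝓝 0)

theorem pen_eq_of_mem {X : Type*} {M Q : Set X} {f : X → EReal} {phi : X → ℝ≥0∞}
    (hphi : IsPenaltyTerm M Q phi) {x : X} (hx : x ∈ M ∩ Q) (c : ℝ) :
    Pen f phi c x = f x := by
  simp [Pen, (hphi x hx.2).2 hx.1]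

theorem pen_eq_of_mem_argminP {X : Type*} {M Q : Set X} {f : X → EReal} {phi : X → ℝ≥0∞}
    {fstar : ℝ} (hphi : IsPenaltyTerm M Q phi) {x : X} (hx : x ∈ argminP M Q f fstar) (c : ℝ) :
    Pen f phi c x = fstar :=
  (pen_eq_of_mem hphi hx.1 c).trans hx.2

/-- Where `F_c` is bounded above by a real number and `f` is not `⊥`, both `f` and `phi`
are finite. -/
theorem exists_real_of_pen_le {X : Type*} {f : X → EReal} {phi : X → ℝ≥0∞} {c a : ℝ} {x : X}
    (hc : 0 < c) (hbot : f x ≠ ⊥) (hle : Pen f phi c x ≤ (a : EReal)) :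
    ∃ u p : ℝ, 0 ≤ p ∧ f x = u ∧ phi x = ENNReal.ofReal p ∧
      ∀ c' : ℝ, Pen f phi c' x = ((u + c' * p : ℝ) : EReal) := by
  have hphi : phi x ≠ ⊤ := by
    intro h
    simp [Pen, h, EReal.coe_mul_top_of_pos hc, EReal.add_top_of_ne_bot hbot] at hle
  have hnonneg : (0 : EReal) ≤ (c : EReal) * (phi x : EReal) :=
    mul_nonneg (by exact_mod_cast hc.le) (EReal.coe_ennreal_nonneg _)
  have hfle : f x ≤ (a : EReal) := (le_add_of_nonneg_right hnonneg).trans hle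
  have htop : f x ≠ ⊤ := (hfle.trans_lt (EReal.coe_lt_top a)).ne
  have hu : f x = ((f x).toReal : EReal) := (EReal.coe_toReal htop hbot).symm
  have hp : phi x = ENNReal.ofReal (phi x).toReal := (ENNReal.ofReal_toReal hphi).symm
  refine ⟨(f x).toReal, (phi x).toReal, ENNReal.toReal_nonneg, hu, hp, fun c' => ?_⟩
  have hp' : (phi x : EReal) = ((phi x).toReal : EReal) :=
    (EReal.coe_ennreal_toReal hphi).symm
  rw [Pen, hp', EReal.coe_add, EReal.coe_mul, ← hu]

theorem ZeroDualityGap.exists_lt_pen {X : Type*} {Q : Set X} {f : X → EReal}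
    {phi : X → ℝ≥0∞} {fstar : ℝ} (h : ZeroDualityGap Q f phi fstar) {t : EReal}
    (ht : t < fstar) : ∃ c : ℝ, 0 ≤ c ∧ ∀ x ∈ Q, t < Pen f phi c x := by
  rw [← h] at ht
  obtain ⟨c, hc⟩ := lt_iSup_iff.1 ht
  obtain ⟨hc0, hc⟩ := lt_iSup_iff.1 hc
  exact ⟨c, hc0, fun x hx => hc.trans_le (iInf₂_le x hx)⟩

theorem ZeroDualityGap.ne_bot {X : Type*} {Q : Set X} {f : X → EReal}
    {phi : X → ℝ≥0∞} {fstar : ℝ} (h : ZeroDualityGap Q f phi fstar) {x : X} (hx : x ∈ Q) :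
    f x ≠ ⊥ := by
  intro hbot
  obtain ⟨c, -, hc⟩ := h.exists_lt_pen (EReal.bot_lt_coe fstar)
  simpa [Pen, hbot] using hc x hx

/-- Along minimizers of the penalty function with growing penalty parameter, the objective
converges to the optimal value. -/
theorem ZeroDualityGap.tendsto_objective {X : Type*} {Q : Set X} {f : X → EReal}
    {phi : X → ℝ≥0∞} {fstar : ℝ} (h : ZeroDualityGap Q f phi fstar) {xc : ℝ → X}
    (hQ : ∀ᶠ c in atTop, xc c ∈ Q) (hle : ∀ᶠ c in atTop, Pen f phi c (xc c) ≤ fstar) :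
    Tendsto (fun c => f (xc c)) atTop (𝓝 (fstar : EReal)) := by
  refine tendsto_order.2 ⟨fun a ha => ?_, fun a ha => ?_⟩
  · obtain ⟨b, hab, hb⟩ := EReal.lt_iff_exists_real_btwn.1 ha
    have hb' : b < fstar := by exact_mod_cast hb
    obtain ⟨c₁, hc₁, hlt⟩ := h.exists_lt_pen (t := ((b + fstar) / 2 : ℝ))
      (by exact_mod_cast (by linarith : (b + fstar) / 2 < fstar))
    filter_upwards [hQ, hle, eventually_ge_atTop (2 * c₁), eventually_gt_atTop 0]
      with c hcQ hcle hc hc0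
    obtain ⟨u, p, hp, hu, -, hpen⟩ := exists_real_of_pen_le hc0 (h.ne_bot hcQ) hcle
    have h₁ := hlt _ hcQ
    rw [hpen, EReal.coe_lt_coe_iff] at h₁
    rw [hpen, EReal.coe_le_coe_iff] at hcle
    rw [hu]
    refine hab.trans ?_
    rw [EReal.coe_lt_coe_iff]
    nlinarith [mul_le_mul_of_nonneg_right hc hp]
  · filter_upwards [hQ, hle, eventually_gt_atTop 0] with c hcQ hcle hc0
    obtain ⟨u, p, hp, hu, -, hpen⟩ := exists_real_of_pen_le hc0 (h.ne_bot hcQ) hcle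
    rw [hpen, EReal.coe_le_coe_iff] at hcle
    refine lt_of_le_of_lt ?_ ha
    rw [hu, EReal.coe_le_coe_iff]
    nlinarith [mul_nonneg hc0.le hp]

theorem GloballyExactPen.fstar_le_pen {X : Type*} {M Q : Set X} {f : X → EReal}
    {phi : X → ℝ≥0∞} {fstar : ℝ} (hphi : IsPenaltyTerm M Q phi)
    (hne : (argminP M Q f fstar).Nonempty) (h : GloballyExactPen M Q f phi fstar) :
    ∃ cs : ℝ, 0 ≤ cs ∧ ∀ c ≥ cs, ∀ y ∈ Q, (fstar : EReal) ≤ Pen f phi c y := by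
  obtain ⟨cs, hcs, h⟩ := h
  obtain ⟨x, hx⟩ := hne
  refine ⟨cs, hcs, fun c hc y hy => ?_⟩
  have hx' := hx
  rw [← h c hc] at hx'
  exact pen_eq_of_mem_argminP hphi hx c ▸ hx'.2 y hy

theorem globallyExactPen_of_fstar_le_pen {X : Type*} {M Q : Set X} {f : X → EReal}
    {phi : X → ℝ≥0∞} {fstar c₀ : ℝ} (hphi : IsPenaltyTerm M Q phi)
    (hne : (argminP M Q f fstar).Nonempty) (hc₀ : 0 ≤ c₀) (hbot : ∀ x ∈ Q, f x ≠ ⊥)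
    (hmin : ∀ y ∈ Q, (fstar : EReal) ≤ Pen f phi c₀ y) :
    GloballyExactPen M Q f phi fstar := by
  refine ⟨c₀ + 1, by linarith, fun c hc => Set.ext fun x =>
    ⟨?_, fun hx => ⟨hx.1.2, fun y hy => ?_⟩⟩⟩
  · rintro ⟨hxQ, hx⟩
    obtain ⟨z, hz⟩ := hne
    have hle : Pen f phi c x ≤ fstar := pen_eq_of_mem_argminP hphi hz c ▸ hx z hz.1.2
    obtain ⟨u, p, hp, hu, hpx, hpen⟩ :=
      exists_real_of_pen_le (by linarith : 0 < c) (hbot x hxQ) hle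
    have hge := hmin x hxQ
    rw [hpen, EReal.coe_le_coe_iff] at hge hle
    have hp0 : p = 0 := by nlinarith
    subst hp0
    refine ⟨⟨(hphi x hxQ).1 (by simp [hpx]), hxQ⟩, ?_⟩
    rw [hu, EReal.coe_eq_coe_iff]
    linarith
  · rw [pen_eq_of_mem_argminP hphi hx]
    refine (hmin y hy).trans (add_le_add le_rfl ?_)
    exact mul_le_mul_of_nonneg_right (by exact_mod_cast (by linarith : c₀ ≤ c))
      (EReal.coe_ennreal_nonneg _)

theorem GloballyExactPen.zeroDualityGap {X : Type*} {M Q : Set X} {f : X → EReal}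
    {phi : X → ℝ≥0∞} {fstar : ℝ} (hphi : IsPenaltyTerm M Q phi)
    (hne : (argminP M Q f fstar).Nonempty) (h : GloballyExactPen M Q f phi fstar) :
    ZeroDualityGap Q f phi fstar := by
  obtain ⟨cs, hcs, hmin⟩ := h.fstar_le_pen hphi hne
  obtain ⟨x, hx⟩ := hne
  refine le_antisymm (iSup₂_le fun c _ => ?_) ?_
  · exact (iInf₂_le x hx.1.2).trans (pen_eq_of_mem_argminP hphi hx c).le
  · exact le_iSup₂_of_le cs hcs (le_iInf₂ (hmin cs le_rfl))

theorem GloballyExactPen.nondegenerateExt {X : Type*} [MetricSpace X] {M Q : Set X}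
    {f : X → EReal} {phi : X → ℝ≥0∞} {fstar : ℝ} (hphi : IsPenaltyTerm M Q phi)
    (hne : (argminP M Q f fstar).Nonempty) (h : GloballyExactPen M Q f phi fstar) :
    NondegenerateExt M Q f phi := by
  obtain ⟨cs, hcs, hmin⟩ := h.fstar_le_pen hphi hne
  obtain ⟨x, hx⟩ := hne
  refine ⟨cs, hcs, fun _ => x, fun c hc => ⟨hx.1.2, fun y hy => ?_⟩, ?_⟩
  · exact (pen_eq_of_mem_argminP hphi hx c).trans_le (hmin c hc y hy)
  · simp [infDist_zero_of_mem hx.1]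

theorem GloballyExactPen.uniformlyLocallyExact {X : Type*} [MetricSpace X] {M Q : Set X}
    {f : X → EReal} {phi : X → ℝ≥0∞} {fstar : ℝ} (hphi : IsPenaltyTerm M Q phi)
    (hne : (argminP M Q f fstar).Nonempty) (h : GloballyExactPen M Q f phi fstar) :
    UniformlyLocallyExact M Q f phi fstar := by
  obtain ⟨cs, hcs, hmin⟩ := h.fstar_le_pen hphi hne
  have hglob : ∀ x ∈ argminP M Q f fstar, ∀ c ≥ cs, ∀ y ∈ Q, Pen f phi c x ≤ Pen f phi c y :=
    fun x hx c hc y hy => (pen_eq_of_mem_argminP hphi hx c).trans_le (hmin c hc y hy)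
  have hloc : ∀ x ∈ argminP M Q f fstar, ∀ c ≥ cs, IsLocalMinOnSet (Pen f phi c) Q x :=
    fun x hx c hc => ⟨1, one_pos, fun y hy _ => hglob x hx c hc y hy⟩
  refine ⟨fun x hx => ⟨cs, hcs, hloc x hx⟩, cs + 1, 1, by linarith, one_pos,
    fun x hx => ⟨?_, ?_⟩⟩
  · have hle : penCStarAt f phi Q x ≤ cs := csInf_le ⟨0, fun _ hc => hc.1⟩ ⟨hcs, hloc x hx⟩
    exact hle.trans_lt (lt_add_one cs)
  · exact le_sSup (mem_image_of_mem _
      ⟨one_pos, fun c hc y hy _ => hglob x hx c (by linarith) y hy⟩)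

theorem fstar_le_pen_of_dist_lt {X : Type*} [MetricSpace X] {M Q : Set X} {f : X → EReal}
    {phi : X → ℝ≥0∞} {fstar cs rs c : ℝ} (hphi : IsPenaltyTerm M Q phi) {x y : X}
    (hx : x ∈ argminP M Q f fstar) (hrs : (rs : EReal) ≤ penRadiusAt f phi Q x cs)
    (hc : cs ≤ c) (hy : y ∈ Q) (hd : dist y x < rs) : (fstar : EReal) ≤ Pen f phi c y := by
  have hlt : ((dist y x : ℝ) : EReal) < penRadiusAt f phi Q x cs :=
    (EReal.coe_lt_coe_iff.2 hd).trans_le hrs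
  obtain ⟨_, ⟨r, hr, rfl⟩, hdr⟩ := lt_sSup_iff.1 hlt
  rw [← pen_eq_of_mem_argminP hphi hx c]
  exact hr.2 c hc y hy (EReal.coe_lt_coe_iff.1 hdr).le

/-- For a problem weakly Levitin-Polyak well-posed in the extended
sense, the penalty function is globally exact iff it has the zero duality gap property,
is non-degenerate in the extended sense, and is uniformly locally exact at globally
optimal solutions. -/
theorem stmt14 {X : Type*} [MetricSpace X] (M Q : Set X) (f : X → EReal) (phi : X → ℝ≥0∞)
    (fstar : ℝ)
    (hM : M.Nonempty) (hQ : Q.Nonempty) (hfeas : (M ∩ Q).Nonempty)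
    (hphi : IsPenaltyTerm M Q phi)
    (hopt : (⨅ x ∈ M ∩ Q, f x) = (fstar : EReal))
    (hwp : WeakLevitinPolyakWPExt M Q f fstar) :
    GloballyExactPen M Q f phi fstar ↔
      ZeroDualityGap Q f phi fstar ∧
        NondegenerateExt M Q f phi ∧
        UniformlyLocallyExact M Q f phi fstar := by
  have hne := hwp.1
  refine ⟨fun h => ⟨h.zeroDualityGap hphi hne, h.nondegenerateExt hphi hne,
    h.uniformlyLocallyExact hphi hne⟩, ?_⟩
  rintro ⟨hgap, ⟨c₀, hc₀, xc, hxc, hdist⟩, -, cs, rs, -, hrs, hunif⟩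
  obtain ⟨z, hz⟩ := hne
  have hev : ∀ᶠ c : ℝ in atTop, c₀ ≤ c := eventually_ge_atTop c₀
  have hobj : Tendsto (fun c => f (xc c)) atTop (𝓝 (fstar : EReal)) :=
    hgap.tendsto_objective (hev.mono fun c hc => (hxc c hc).1)
      (hev.mono fun c hc => pen_eq_of_mem_argminP hphi hz c ▸ (hxc c hc).2 z hz.1.2)
  have hcast : Tendsto (fun n : ℕ => (n : ℝ)) atTop atTop := tendsto_natCast_atTop_atTop
  have hlim := hwp.2 (fun n => xc n) (hobj.comp hcast) (hdist.comp hcast)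
  obtain ⟨n, hn, hn₀, hns⟩ := ((hlim.eventually_lt_const hrs).and
    ((hcast.eventually_ge_atTop c₀).and (hcast.eventually_ge_atTop cs))).exists
  obtain ⟨x, hx, hd⟩ := (infDist_lt_iff ⟨z, hz⟩).1 hn
  obtain ⟨hnQ, hnmin⟩ := hxc n hn₀
  have hval := fstar_le_pen_of_dist_lt hphi hx (hunif x hx).2 hns hnQ hd
  exact globallyExactPen_of_fstar_le_pen hphi ⟨z, hz⟩ n.cast_nonneg
    (fun y hy => hgap.ne_bot hy) fun y hy => hval.trans (hnmin y hy)
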